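/- arXiv:2202.13993 — 2 statements merged into one kernel-verified Lean document; each statement's English description precedes it below -/
import Mathlib

section
/- Let g, d be positive integers and s ∈ [0,1]^g with s_1^2 + … + s_g^2 ≤ 1. Then s ∈ Γ(g,d): for every g-tuple of d×d effects E_1,…,E_g, the noisy effects s_i E_i + (1−s_i) I/2 are compatible. -/
open Matrix ComplexOrder

noncomputable section

/-- A quantum effect: `0 ≤ E ≤ I` in the Loewner order. -/
def IsEffect {d : ℕ} (E : Matrix (Fin d) (Fin d) ℂ) : Prop :=
  E.PosSemidef ∧ ((1 : Matrix (Fin d) (Fin d) ℂ) - E).PosSemidef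

/-- Effects `E i` are compatible if the dichotomic POVMs `(E i, I - E i)` are jointly measurable:
there is a joint POVM `(K ε)` indexed by sign vectors with `E i = ∑_{ε : ε i = 1} K ε`. -/
def CompatibleEffects {g d : ℕ} (E : Fin g → Matrix (Fin d) (Fin d) ℂ) : Prop :=
  ∃ K : (Fin g → Bool) → Matrix (Fin d) (Fin d) ℂ,
    (∀ ε, (K ε).PosSemidef) ∧ (∑ ε, K ε = 1) ∧
    ∀ i, E i = ∑ ε ∈ Finset.univ.filter (fun ε : Fin g → Bool => ε i = true), K ε

/-- The compatibility region `Γ(g, d)` for dichotomic measurements. -/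
def GammaD (g d : ℕ) : Set (Fin g → ℝ) :=
  {s | (∀ i, s i ∈ Set.Icc (0 : ℝ) 1) ∧
    ∀ E : Fin g → Matrix (Fin d) (Fin d) ℂ, (∀ i, IsEffect (E i)) →
      CompatibleEffects (fun i => s i • E i +
        ((1 - s i) * (2 : ℝ)⁻¹) • (1 : Matrix (Fin d) (Fin d) ℂ))}

/-- The sign `±1` encoded by a Boolean. -/
def boolSign (b : Bool) : ℝ := if b then 1 else -1

lemma boolSign_not (b : Bool) : boolSign (!b) = -boolSign b := by
  cases b <;> simp [boolSign]

lemma boolSign_mul_self (b : Bool) : boolSign b * boolSign b = 1 := by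
  cases b <;> simp [boolSign]

section SignSums

variable {ι M R : Type*} [Fintype ι]

/-- The signed sum `∑ i, ± C i`. -/
def signedSum [AddCommGroup M] [Module ℝ M] (C : ι → M) (ε : ι → Bool) : M :=
  ∑ i, boolSign (ε i) • C i

lemma signedSum_not [AddCommGroup M] [Module ℝ M] (C : ι → M) (ε : ι → Bool) :
    signedSum C (fun k => !ε k) = -signedSum C ε := by
  simp [signedSum, boolSign_not]

variable [DecidableEq ι]

lemma sum_eq_zero_of_forall_comp_not_eq_neg [AddCommGroup M] [Module ℝ M] (f : (ι → Bool) → M)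
    (h : ∀ ε, f (fun k => !ε k) = -f ε) : ∑ ε, f ε = 0 := by
  have e : Function.Involutive (fun (ε : ι → Bool) k => !ε k) := fun ε => by simp
  have h1 : ∑ ε, f ε = -∑ ε, f ε := by
    rw [← Finset.sum_neg_distrib, ← Equiv.sum_comp e.toPerm f]
    exact Finset.sum_congr rfl fun ε _ => h ε
  have h2 : (2 : ℝ) • ∑ ε, f ε = 0 := by
    rw [two_smul]
    nth_rewrite 1 [h1]
    exact neg_add_cancel _
  exact (smul_eq_zero_iff_right two_ne_zero).mp h2

lemma sum_boolSign_mul_boolSign (i j : ι) :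
    ∑ ε : ι → Bool, boolSign (ε i) * boolSign (ε j) =
      if i = j then (2 : ℝ) ^ Fintype.card ι else 0 := by
  split_ifs with hij
  · subst hij
    simp [boolSign_mul_self]
  · have e : Function.Involutive (fun ε : ι → Bool => Function.update ε i (!ε i)) := fun ε => by
      simp
    have h1 : ∑ ε : ι → Bool, boolSign (ε i) * boolSign (ε j) =
        -∑ ε : ι → Bool, boolSign (ε i) * boolSign (ε j) := by
      rw [← Finset.sum_neg_distrib,
        ← Equiv.sum_comp e.toPerm fun ε : ι → Bool => boolSign (ε i) * boolSign (ε j)]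
      refine Finset.sum_congr rfl fun ε _ => ?_
      simp [Function.update_of_ne (Ne.symm hij), boolSign_not]
    exact self_eq_neg.mp h1

lemma sum_boolSign_smul_signedSum [AddCommGroup M] [Module ℝ M] (C : ι → M) (i : ι) :
    ∑ ε : ι → Bool, boolSign (ε i) • signedSum C ε = (2 : ℝ) ^ Fintype.card ι • C i := by
  simp only [signedSum, Finset.smul_sum, smul_smul]
  rw [Finset.sum_comm]
  simp [← Finset.sum_smul, sum_boolSign_mul_boolSign]

lemma sum_signedSum_mul_self [Ring R] [Algebra ℝ R] (C : ι → R) :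
    ∑ ε : ι → Bool, signedSum C ε * signedSum C ε =
      (2 : ℝ) ^ Fintype.card ι • ∑ i, C i * C i := by
  calc ∑ ε : ι → Bool, signedSum C ε * signedSum C ε
      = ∑ i, C i * ∑ ε : ι → Bool, boolSign (ε i) • signedSum C ε := by
        simp only [Finset.mul_sum]
        rw [Finset.sum_comm]
        refine Finset.sum_congr rfl fun ε _ => ?_
        conv_lhs => enter [1]; rw [signedSum]
        rw [Finset.sum_mul]
        exact Finset.sum_congr rfl fun i _ => by rw [smul_mul_assoc, mul_smul_comm]
    _ = _ := by
        simp only [sum_boolSign_smul_signedSum, mul_smul_comm, Finset.smul_sum]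

/-- The quadratic joint observable, before normalization, built from the family `C`. -/
def jointQuadratic [Ring R] [Algebra ℝ R] (C : ι → R) (ε : ι → Bool) : R :=
  (2 : ℝ) • 1 + (2 : ℝ) • signedSum C ε + signedSum C ε * signedSum C ε - ∑ i, C i * C i

lemma sum_jointQuadratic [Ring R] [Algebra ℝ R] (C : ι → R) :
    ∑ ε, jointQuadratic C ε = (2 : ℝ) ^ Fintype.card ι • (2 : ℝ) • (1 : R) := by
  have h : ∑ ε, signedSum C ε = 0 :=
    sum_eq_zero_of_forall_comp_not_eq_neg _ (signedSum_not C)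
  simp only [jointQuadratic, Finset.sum_add_distrib, Finset.sum_sub_distrib,
    sum_signedSum_mul_self, ← Finset.smul_sum, h, Finset.sum_const, Finset.card_univ,
    Fintype.card_fun, Fintype.card_bool, ← Nat.cast_smul_eq_nsmul ℝ]
  push_cast
  module

lemma sum_boolSign_smul_jointQuadratic [Ring R] [Algebra ℝ R] (C : ι → R) (i : ι) :
    ∑ ε, boolSign (ε i) • jointQuadratic C ε = (2 : ℝ) ^ Fintype.card ι • (2 : ℝ) • C i := by
  have h : ∑ ε : ι → Bool, boolSign (ε i) •
      ((2 : ℝ) • 1 + signedSum C ε * signedSum C ε - ∑ i, C i * C i) = 0 :=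
    sum_eq_zero_of_forall_comp_not_eq_neg _ fun ε => by
      simp [signedSum_not, boolSign_not]
  calc ∑ ε, boolSign (ε i) • jointQuadratic C ε
      = ∑ ε : ι → Bool, boolSign (ε i) •
          ((2 : ℝ) • 1 + signedSum C ε * signedSum C ε - ∑ i, C i * C i) +
        (2 : ℝ) • ∑ ε : ι → Bool, boolSign (ε i) • signedSum C ε := by
        rw [Finset.smul_sum, ← Finset.sum_add_distrib]
        refine Finset.sum_congr rfl fun ε _ => ?_
        rw [jointQuadratic]
        module
    _ = _ := by
        rw [h, sum_boolSign_smul_signedSum]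
        module

end SignSums

lemma IsEffect.posSemidef_sub_mul_self {d : ℕ} {E : Matrix (Fin d) (Fin d) ℂ} (h : IsEffect E) :
    (E - E * E).PosSemidef := by
  have h1 := h.1.conjTranspose_mul_mul_same (1 - E)
  have h2 := h.2.conjTranspose_mul_mul_same E
  rw [h.2.isHermitian.eq] at h1
  rw [h.1.isHermitian.eq] at h2
  convert h1.add h2 using 1
  noncomm_ring

lemma posSemidef_jointQuadratic {g d : ℕ} {s : Fin g → ℝ} (hsum : ∑ i, s i ^ 2 ≤ 1)
    {E : Fin g → Matrix (Fin d) (Fin d) ℂ} (hE : ∀ i, IsEffect (E i)) (ε : Fin g → Bool) :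
    (jointQuadratic (fun i => s i • ((2 : ℝ) • E i - 1)) ε).PosSemidef := by
  set C : Fin g → Matrix (Fin d) (Fin d) ℂ := fun i => s i • ((2 : ℝ) • E i - 1) with hC
  have hherm : (1 + signedSum C ε)ᴴ = 1 + signedSum C ε := by
    simp [signedSum, hC, Matrix.conjTranspose_sum, Matrix.conjTranspose_smul,
      (hE _).1.isHermitian.eq]
  have hsq : ((1 + signedSum C ε) * (1 + signedSum C ε)).PosSemidef := by
    have := Matrix.posSemidef_conjTranspose_mul_self (1 + signedSum C ε)
    rwa [hherm] at this
  have hdefect : (∑ i, (4 * s i ^ 2) • (E i - E i * E i)).PosSemidef :=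
    Matrix.posSemidef_sum _ fun i _ => (hE i).posSemidef_sub_mul_self.smul (by positivity)
  have hslack : ((1 - ∑ i, s i ^ 2) • (1 : Matrix (Fin d) (Fin d) ℂ)).PosSemidef :=
    Matrix.PosSemidef.one.smul (sub_nonneg.mpr hsum)
  have hCC : ∑ i, C i * C i =
      (∑ i, s i ^ 2) • (1 : Matrix (Fin d) (Fin d) ℂ) -
        ∑ i, (4 * s i ^ 2) • (E i - E i * E i) := by
    rw [Finset.sum_smul, ← Finset.sum_sub_distrib]
    refine Finset.sum_congr rfl fun i _ => ?_
    simp only [hC, sub_mul, mul_sub, one_mul, mul_one, smul_mul_assoc,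
      mul_smul_comm]
    module
  convert (hsq.add hdefect).add hslack using 1
  rw [jointQuadratic, hCC]
  simp only [add_mul, mul_add, one_mul, mul_one]
  module

/-- the quarter-ball `{s ∈ [0,1]^g : ∑ s i ^ 2 ≤ 1}` lies in `Γ(g,d)`. -/
theorem qc_subset_gamma (g d : ℕ) (hg : 0 < g) (hd : 0 < d) (s : Fin g → ℝ)
    (hs : ∀ i, s i ∈ Set.Icc (0 : ℝ) 1) (hsum : ∑ i, s i ^ 2 ≤ 1) :
    s ∈ GammaD g d := by
  refine ⟨hs, fun E hE => ?_⟩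
  set C : Fin g → Matrix (Fin d) (Fin d) ℂ := fun i => s i • ((2 : ℝ) • E i - 1) with hC
  have hc : ((2 : ℝ) ^ g * 2)⁻¹ * ((2 : ℝ) ^ g * 2) = 1 := inv_mul_cancel₀ (by positivity)
  have hone : ∑ ε, ((2 : ℝ) ^ g * 2)⁻¹ • jointQuadratic C ε = 1 := by
    rw [← Finset.smul_sum, sum_jointQuadratic, Fintype.card_fin, smul_smul, smul_smul, mul_assoc, hc,
      one_smul]
  have hsign (i : Fin g) :
      ∑ ε, boolSign (ε i) • ((2 : ℝ) ^ g * 2)⁻¹ • jointQuadratic C ε = C i := by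
    simp only [smul_comm (boolSign _)]
    rw [← Finset.smul_sum, sum_boolSign_smul_jointQuadratic, Fintype.card_fin, smul_smul, smul_smul,
      mul_assoc, hc, one_smul]
  refine ⟨fun ε => ((2 : ℝ) ^ g * 2)⁻¹ • jointQuadratic C ε, fun ε =>
    (posSemidef_jointQuadratic hsum hE ε).smul (by positivity), hone, fun i => ?_⟩
  calc s i • E i + ((1 - s i) * (2 : ℝ)⁻¹) • (1 : Matrix (Fin d) (Fin d) ℂ)
      = (2 : ℝ)⁻¹ • (1 + C i) := by
        simp only [hC]
        module
    _ = _ := by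
        rw [← hsign i, ← hone, ← Finset.sum_add_distrib, Finset.smul_sum, Finset.sum_filter]
        refine Finset.sum_congr rfl fun ε _ => ?_
        cases ε i
        · simp [boolSign]
        · simp only [boolSign, if_true]
          module
end
end

section
/- Let g, d be positive integers with d ≥ 2^{⌈(g−1)/2⌉}. Then Γ(g,d) = {s ∈ [0,1]^g : s_1^2 + … + s_g^2 ≤ 1}: a noise vector s renders all g-tuples of d×d effects compatible if and only if its Euclidean norm is at most 1. -/
open Matrix ComplexOrder

noncomputable section

/-- Hermitian matrices `B i` that are the `±1`-valued marginal expectations of a joint POVM. -/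
def JointSigned {g : ℕ} {n : Type} [Fintype n] [DecidableEq n]
    (B : Fin g → Matrix n n ℂ) : Prop :=
  ∃ K : (Fin g → Bool) → Matrix n n ℂ,
    (∀ ε, (K ε).PosSemidef) ∧ (∑ ε, K ε = 1) ∧ ∀ i, ∑ ε, boolSign (ε i) • K ε = B i

lemma compatibleEffects_iff_jointSigned {g d : ℕ} (E : Fin g → Matrix (Fin d) (Fin d) ℂ) :
    CompatibleEffects E ↔ JointSigned (fun i => (2 : ℝ) • E i - 1) := by
  unfold CompatibleEffects JointSigned
  refine exists_congr fun K => and_congr_right fun _ => and_congr_right fun hK =>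
    forall_congr' fun i => ?_
  have key : ∑ ε, boolSign (ε i) • K ε =
      (2 : ℝ) • ∑ ε ∈ Finset.univ.filter (fun ε : Fin g → Bool => ε i = true), K ε - 1 := by
    rw [← hK, Finset.sum_filter, Finset.smul_sum, ← Finset.sum_sub_distrib]
    refine Finset.sum_congr rfl fun ε _ => ?_
    cases h : ε i <;> simp [boolSign, two_smul]
  rw [key]
  constructor
  · intro h
    simp only [h]
  · intro h
    exact (smul_right_injective _ (two_ne_zero' ℝ) (sub_left_injective h)).symm

section Isometry

variable {m n : Type} [Fintype m] [DecidableEq m] [Fintype n] [DecidableEq n]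

lemma JointSigned.compress {g : ℕ} {B : Fin g → Matrix n n ℂ} (hB : JointSigned B)
    {V : Matrix n m ℂ} (hV : Vᴴ * V = 1) : JointSigned (fun i => Vᴴ * B i * V) := by
  obtain ⟨K, hK, hsum, hmarg⟩ := hB
  refine ⟨fun ε => Vᴴ * K ε * V, fun ε => (hK ε).conjTranspose_mul_mul_same V, ?_, fun i => ?_⟩
  · simp only [← Matrix.sum_mul, ← Matrix.mul_sum, hsum, Matrix.mul_one, hV]
  · simp only [← hmarg i, Matrix.sum_mul, Matrix.mul_sum, Matrix.smul_mul, Matrix.mul_smul]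

omit [DecidableEq n] in
lemma compress_conj {V : Matrix n m ℂ} (hV : Vᴴ * V = 1) (A : Matrix m m ℂ) :
    Vᴴ * (V * A * Vᴴ) * V = A := by
  calc Vᴴ * (V * A * Vᴴ) * V = (Vᴴ * V) * A * (Vᴴ * V) := by simp only [Matrix.mul_assoc]
    _ = A := by rw [hV, Matrix.one_mul, Matrix.mul_one]

lemma posSemidef_one_sub_conj {V : Matrix n m ℂ} (hV : Vᴴ * V = 1) {A : Matrix m m ℂ}
    (hA : (1 - A).PosSemidef) : (1 - V * A * Vᴴ).PosSemidef := by
  have hproj : (1 - V * Vᴴ)ᴴ * (1 - V * Vᴴ) = 1 - V * Vᴴ := by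
    have h : V * Vᴴ * (V * Vᴴ) = V * Vᴴ := by
      rw [Matrix.mul_assoc, ← Matrix.mul_assoc Vᴴ, hV, Matrix.one_mul]
    simp [sub_mul, mul_sub, h]
  have hsplit : 1 - V * A * Vᴴ = (1 - V * Vᴴ)ᴴ * (1 - V * Vᴴ) + V * (1 - A) * Vᴴ := by
    rw [hproj, Matrix.mul_sub, Matrix.sub_mul, Matrix.mul_one]
    abel
  rw [hsplit]
  exact (posSemidef_conjTranspose_mul_self _).add (hA.mul_mul_conjTranspose_same V)

lemma posSemidef_one_add_conj {V : Matrix n m ℂ} (hV : Vᴴ * V = 1) {A : Matrix m m ℂ}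
    (hA : (1 + A).PosSemidef) : (1 + V * A * Vᴴ).PosSemidef := by
  have h := posSemidef_one_sub_conj hV (A := -A) (by simpa using hA)
  simpa using h

end Isometry

section QuarterCircle

/-- The coefficients `α`, `β` of the Kraus operators `α ± β R` of an unsharp measurement
of a reflection `R` with sharpness `c`. -/
lemma exists_kraus_coeffs {c r : ℝ} (hr : 0 ≤ r) (h : c ^ 2 + r ^ 2 = 1) :
    ∃ α β : ℝ, α ^ 2 + β ^ 2 = 1 / 2 ∧ α * β = c / 4 ∧ α ^ 2 - β ^ 2 = r / 2 := by
  have hc1 : c ≤ 1 := by nlinarith [sq_nonneg r]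
  have hc2 : -1 ≤ c := by nlinarith [sq_nonneg r]
  have hu := Real.sq_sqrt (show (0 : ℝ) ≤ (1 + c) / 8 by linarith)
  have hv := Real.sq_sqrt (show (0 : ℝ) ≤ (1 - c) / 8 by linarith)
  have huv : √((1 + c) / 8) * √((1 - c) / 8) = r / 8 := by
    rw [← Real.sqrt_mul (by linarith), ← Real.sqrt_sq (show 0 ≤ r / 8 by linarith)]
    congr 1
    linarith
  refine ⟨√((1 + c) / 8) + √((1 - c) / 8), √((1 + c) / 8) - √((1 - c) / 8), ?_, ?_, ?_⟩ <;>
    linarith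

variable {n : Type} [Fintype n] [DecidableEq n]

/-- Measuring a reflection `R` unsharply before a suitable joint measurement. -/
lemma JointSigned.cons_reflection {g : ℕ} {R : Matrix n n ℂ} (hR : Rᴴ = R) (hRR : R * R = 1)
    {c r : ℝ} (hr : 0 ≤ r) (hcr : c ^ 2 + r ^ 2 = 1) (t : Fin g → ℝ) (A : Fin g → Matrix n n ℂ)
    (h : JointSigned fun i => t i • (((1 + r) / 2) • A i - ((1 - r) / 2) • (R * A i * R))) :
    JointSigned (Fin.cons (c • R) fun i => (r * t i) • A i : Fin (g + 1) → Matrix n n ℂ) := by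
  obtain ⟨α, β, hs, hp, hd⟩ := exists_kraus_coeffs hr hcr
  obtain ⟨K, hK, hsum, hmarg⟩ := h
  set L : Bool → Matrix n n ℂ := fun b => α • 1 + (boolSign b * β) • R with hL
  have hLH : ∀ b, (L b)ᴴ = L b := fun b => by
    simp [hL, conjTranspose_add, conjTranspose_smul, hR]
  have hLt : L true = α • 1 + β • R := by simp [hL, boolSign]
  have hLf : L false = α • 1 - β • R := by simp [hL, boolSign, sub_eq_add_neg]
  have hsq : ∀ b, L b * L b = (1 / 2 : ℝ) • 1 + (boolSign b * (c / 2)) • R := fun b => by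
    have hb := boolSign_mul_self b
    simp only [hL, add_mul, mul_add, Matrix.smul_mul, Matrix.mul_smul, Matrix.one_mul,
      Matrix.mul_one, hRR]
    have e1 : (1 / 2 : ℝ) = α * α + (boolSign b * β) * (boolSign b * β) := by
      linear_combination -hs + (-β ^ 2) * hb
    have e2 : c / 2 = 2 * (α * β) := by rw [hp]; ring
    rw [e1, e2]
    module
  have hsplit : ∀ f : (Fin (g + 1) → Bool) → Matrix n n ℂ,
      ∑ ε, f ε = ∑ b, ∑ ε : Fin g → Bool, f (Fin.cons b ε) := fun f => by
    rw [← Fintype.sum_prod_type']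
    exact (Fintype.sum_equiv (Fin.consEquiv fun _ => Bool) _ _ fun _ => rfl).symm
  have hpull : ∀ b, ∀ w : (Fin g → Bool) → ℝ,
      ∑ ε, w ε • (L b * K ε * L b) = L b * (∑ ε, w ε • K ε) * L b := fun b w => by
    simp only [Finset.sum_mul, Finset.mul_sum, Matrix.smul_mul, Matrix.mul_smul]
  have hone : ∀ b, ∑ ε, L b * K ε * L b = L b * L b := fun b => by
    rw [← Finset.sum_mul, ← Finset.mul_sum, hsum, Matrix.mul_one]
  refine ⟨fun ε => L (ε 0) * K (Fin.tail ε) * L (ε 0), fun ε => ?_, ?_, fun i => ?_⟩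
  · have := (hK (Fin.tail ε)).conjTranspose_mul_mul_same (L (ε 0))
    rwa [hLH] at this
  · rw [hsplit]
    simp only [Fin.cons_zero, Fin.tail_cons, hone, hsq, Fintype.sum_bool]
    simp only [boolSign]
    norm_num
    module
  · rw [hsplit]
    refine Fin.cases ?_ (fun j => ?_) i
    · simp only [Fin.cons_zero, Fin.tail_cons, ← Finset.smul_sum, hone, hsq, Fintype.sum_bool]
      simp only [boolSign]
      norm_num
      module
    · simp only [Fin.cons_zero, Fin.tail_cons, Fin.cons_succ, hpull, hmarg, Fintype.sum_bool]
      have hRRA : R * (R * A j * R) * R = A j := by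
        calc R * (R * A j * R) * R = (R * R) * A j * (R * R) := by simp only [Matrix.mul_assoc]
          _ = A j := by rw [hRR, Matrix.one_mul, Matrix.mul_one]
      have hpair : ∀ X, L true * X * L true + L false * X * L false =
          (2 * α ^ 2) • X + (2 * β ^ 2) • (R * X * R) := fun X => by
        rw [hLt, hLf]
        simp only [add_mul, mul_add, sub_mul, mul_sub, Matrix.smul_mul, Matrix.mul_smul,
          Matrix.one_mul, Matrix.mul_one]
        module
      rw [hpair]
      simp only [Matrix.mul_sub, Matrix.sub_mul, Matrix.smul_mul, Matrix.mul_smul, hRRA]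
      have e1 : α ^ 2 = 1 / 4 + r / 4 := by linarith
      have e2 : β ^ 2 = 1 / 4 - r / 4 := by linarith
      rw [e1, e2]
      module

open scoped MatrixOrder Matrix.Norms.L2Operator in
lemma Matrix.PosSemidef.exists_eq_conjTranspose_mul_self {A : Matrix n n ℂ}
    (hA : A.PosSemidef) : ∃ B : Matrix n n ℂ, A = Bᴴ * B :=
  CStarAlgebra.nonneg_iff_eq_star_mul_self.mp hA.nonneg

/-- Every Hermitian contraction is the compression of a reflection. -/
lemma exists_reflection_dilation {A : Matrix n n ℂ} (h₁ : (1 - A).PosSemidef)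
    (h₂ : (1 + A).PosSemidef) :
    ∃ (V : Matrix (n ⊕ n) n ℂ) (R : Matrix (n ⊕ n) (n ⊕ n) ℂ),
      Vᴴ * V = 1 ∧ Rᴴ = R ∧ R * R = 1 ∧ Vᴴ * R * V = A := by
  obtain ⟨M, hM⟩ :=
    (h₂.smul (show (0 : ℝ) ≤ 1 / 2 by norm_num)).exists_eq_conjTranspose_mul_self
  obtain ⟨N, hN⟩ :=
    (h₁.smul (show (0 : ℝ) ≤ 1 / 2 by norm_num)).exists_eq_conjTranspose_mul_self
  refine ⟨fromRows M N, fromBlocks 1 0 0 (-1), ?_, ?_, ?_, ?_⟩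
  · rw [conjTranspose_fromRows_eq_fromCols_conjTranspose, fromCols_mul_fromRows, ← hM, ← hN]
    module
  · simp [fromBlocks_conjTranspose]
  · simp [fromBlocks_multiply]
  · rw [Matrix.mul_assoc, fromBlocks_mul_fromRows,
      conjTranspose_fromRows_eq_fromCols_conjTranspose, fromCols_mul_fromRows]
    simp only [Matrix.one_mul, Matrix.zero_mul, Matrix.neg_mul, add_zero, zero_add,
      Matrix.mul_neg, ← hM, ← hN]
    module

lemma posSemidef_one_sub_twist {R A : Matrix n n ℂ} (hR : Rᴴ = R) (hRR : R * R = 1) {r : ℝ}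
    (hr₀ : 0 ≤ r) (hr₁ : r ≤ 1) (h₁ : (1 - A).PosSemidef) (h₂ : (1 + A).PosSemidef) :
    (1 - (((1 + r) / 2) • A - ((1 - r) / 2) • (R * A * R))).PosSemidef := by
  have hconj : (1 + R * A * R).PosSemidef := by
    have := posSemidef_one_add_conj (V := R) (by rw [hR, hRR]) h₂
    rwa [hR] at this
  have h := (h₁.smul (show 0 ≤ (1 + r) / 2 by linarith)).add
    (hconj.smul (show 0 ≤ (1 - r) / 2 by linarith))
  convert h using 1
  module

end QuarterCircle

/-- A noise vector in the unit ball makes all Hermitian contractions jointly measurable. -/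
theorem jointSigned_of_sum_sq_le_one {g : ℕ} {n : Type} [Fintype n] [DecidableEq n]
    (A : Fin g → Matrix n n ℂ) (h₁ : ∀ i, (1 - A i).PosSemidef) (h₂ : ∀ i, (1 + A i).PosSemidef)
    (s : Fin g → ℝ) (hs : ∑ i, s i ^ 2 ≤ 1) : JointSigned fun i => s i • A i := by
  induction g generalizing n with
  | zero => exact ⟨fun _ => 1, fun _ => PosSemidef.one, by simp, fun i => i.elim0⟩
  | succ g ih =>
    rw [Fin.sum_univ_succ] at hs
    obtain ⟨V, R, hV, hR, hRR, hVR⟩ := exists_reflection_dilation (h₁ 0) (h₂ 0)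
    have hq : 0 ≤ ∑ i : Fin g, s i.succ ^ 2 := Finset.sum_nonneg fun i _ => sq_nonneg _
    set r := √(1 - s 0 ^ 2) with hr
    have hr₀ : 0 ≤ r := Real.sqrt_nonneg _
    have hr₂ : r ^ 2 = 1 - s 0 ^ 2 := Real.sq_sqrt (by linarith)
    have hr₁ : r ≤ 1 := by nlinarith [sq_nonneg (s 0)]
    have hst : ∀ i : Fin g, r * (s i.succ / r) = s i.succ := fun i => by
      rcases eq_or_ne r 0 with h0 | h0
      · have hle := Finset.single_le_sum (f := fun i : Fin g => s i.succ ^ 2)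
          (fun i _ => sq_nonneg _) (Finset.mem_univ i)
        have hz : s i.succ ^ 2 = 0 := le_antisymm (by rw [h0] at hr₂; linarith) (sq_nonneg _)
        rw [pow_eq_zero_iff two_ne_zero] at hz
        rw [hz, h0, zero_mul]
      · field_simp
    have hB₁ : ∀ i : Fin g, (1 - V * A i.succ * Vᴴ).PosSemidef := fun i =>
      posSemidef_one_sub_conj hV (h₁ _)
    have hB₂ : ∀ i : Fin g, (1 + V * A i.succ * Vᴴ).PosSemidef := fun i =>
      posSemidef_one_add_conj hV (h₂ _)
    have hJ := JointSigned.cons_reflection hR hRR (c := s 0) hr₀ (by linarith)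
      (fun i : Fin g => s i.succ / r) (fun i => V * A i.succ * Vᴴ)
      (ih _ (fun i => posSemidef_one_sub_twist hR hRR hr₀ hr₁ (hB₁ i) (hB₂ i))
        (fun i => by
          have h := posSemidef_one_sub_twist hR hRR hr₀ hr₁
            (A := -(V * A i.succ * Vᴴ)) (by simpa using hB₂ i)
            (by simpa [← sub_eq_add_neg] using hB₁ i)
          convert h using 1
          simp only [Matrix.mul_neg, Matrix.neg_mul]
          module)
        (fun i => s i.succ / r) (by
          simp only [div_pow, ← Finset.sum_div]
          exact div_le_one_of_le₀ (by linarith) (sq_nonneg _)))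
    have hfin := hJ.compress hV
    convert hfin using 1
    funext i
    refine Fin.cases ?_ (fun j => ?_) i
    · simp [hVR]
    · simp only [Fin.cons_succ, hst, Matrix.mul_smul, Matrix.smul_mul, compress_conj hV]

section Clifford

lemma exists_anticommuting_reflections (k : ℕ) :
    ∃ (m : Type) (_ : Fintype m) (_ : DecidableEq m) (F : Fin (2 * k + 1) → Matrix m m ℂ),
      Fintype.card m = 2 ^ k ∧ (∀ i, (F i)ᴴ = F i) ∧ (∀ i, F i * F i = 1) ∧
      ∀ i j, i ≠ j → F i * F j + F j * F i = 0 := by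
  induction k with
  | zero =>
    exact ⟨Unit, inferInstance, inferInstance, fun _ => 1, by simp, by simp, by simp,
      fun i j h => (h (Subsingleton.elim (α := Fin 1) i j)).elim⟩
  | succ k ih =>
    obtain ⟨m, _, _, F, hcard, hH, hsq, hanti⟩ := ih
    refine ⟨m ⊕ m, inferInstance, inferInstance,
      (Fin.cons (fromBlocks 1 0 0 (-1)) (Fin.cons (fromBlocks 0 (-Complex.I • 1) (Complex.I • 1) 0)
        fun i => fromBlocks 0 (F i) (F i) 0) : Fin (2 * k + 1 + 1 + 1) → _), ?_, ?_, ?_, ?_⟩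
    · rw [Fintype.card_sum, hcard]
      ring
    · refine Fin.cases ?_ (Fin.cases ?_ fun i => ?_)
      · simp [fromBlocks_conjTranspose]
      · simp [fromBlocks_conjTranspose, conjTranspose_smul]
      · simp [fromBlocks_conjTranspose, hH]
    · refine Fin.cases ?_ (Fin.cases ?_ fun i => ?_)
      · simp [fromBlocks_multiply]
      · simp [fromBlocks_multiply, smul_smul]
      · simp [fromBlocks_multiply, hsq]
    · refine Fin.cases (Fin.cases ?_ (Fin.cases ?_ fun j => ?_))
        (Fin.cases (Fin.cases ?_ (Fin.cases ?_ fun j => ?_))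
          fun i => Fin.cases ?_ (Fin.cases ?_ fun j => ?_)) <;> intro h
      all_goals first
        | exact (h rfl).elim
        | (simp [fromBlocks_multiply, fromBlocks_add]; done)
        | skip
      have hij := hanti i j fun e => h (by rw [e])
      simp [fromBlocks_multiply, fromBlocks_add, hij]

variable {m : Type} [Fintype m] [DecidableEq m] {g : ℕ} {F : Fin g → Matrix m m ℂ}

lemma sum_smul_mul_self_of_anticommute (hsq : ∀ i, F i * F i = 1)
    (hanti : ∀ i j, i ≠ j → F i * F j + F j * F i = 0) (a : Fin g → ℝ) :
    (∑ i, a i • F i) * (∑ i, a i • F i) = (∑ i, a i ^ 2) • (1 : Matrix m m ℂ) := by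
  have hdouble : (∑ i, a i • F i) * (∑ i, a i • F i) =
      ∑ i, ∑ j, (a i * a j) • (F i * F j) := by
    simp only [Finset.sum_mul_sum, smul_mul_smul_comm]
  have hswap : (∑ i, a i • F i) * (∑ i, a i • F i) =
      ∑ i, ∑ j, (a i * a j) • (F j * F i) := by
    rw [hdouble, Finset.sum_comm]
    exact Finset.sum_congr rfl fun i _ => Finset.sum_congr rfl fun j _ => by rw [mul_comm (a i)]
  have htwo : (2 : ℝ) • ((∑ i, a i • F i) * (∑ i, a i • F i)) =
      (2 : ℝ) • (∑ i, a i ^ 2) • (1 : Matrix m m ℂ) := by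
    rw [two_smul]
    nth_rewrite 1 [hdouble]
    rw [hswap, ← Finset.sum_add_distrib, Finset.sum_smul, Finset.smul_sum]
    refine Finset.sum_congr rfl fun i _ => ?_
    rw [← Finset.sum_add_distrib, Finset.sum_eq_single i]
    · rw [hsq]
      module
    · intro j _ hj
      rw [← smul_add, hanti i j hj.symm, smul_zero]
    · simp
  exact smul_right_injective _ (two_ne_zero' ℝ) htwo

lemma sum_sq_le_one_of_jointSigned [Nonempty m] (hH : ∀ i, (F i)ᴴ = F i)
    (hsq : ∀ i, F i * F i = 1) (hanti : ∀ i j, i ≠ j → F i * F j + F j * F i = 0)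
    {s : Fin g → ℝ} (h : JointSigned fun i => s i • F i) : ∑ i, s i ^ 2 ≤ 1 := by
  obtain ⟨K, hK, hsum, hmarg⟩ := h
  set q := ∑ i, s i ^ 2 with hq
  set Y : (Fin g → Bool) → Matrix m m ℂ := fun ε => ∑ i, (boolSign (ε i) * s i) • F i with hY
  have hYH : ∀ ε, (1 - Y ε)ᴴ = 1 - Y ε := fun ε => by
    simp [hY, conjTranspose_sum, conjTranspose_smul, hH]
  have hYsq : ∀ ε, (1 - Y ε) * (1 - Y ε) = (1 + q) • 1 - (2 : ℝ) • Y ε := fun ε => by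
    have h := sum_smul_mul_self_of_anticommute hsq hanti fun i => boolSign (ε i) * s i
    simp only [mul_pow, pow_two (boolSign _), boolSign_mul_self, one_mul] at h
    rw [sub_mul, mul_sub, mul_sub, h]
    simp only [Matrix.one_mul, Matrix.mul_one]
    module
  have hpos : ∀ ε, 0 ≤ (K ε * ((1 - Y ε) * (1 - Y ε))).trace := fun ε => by
    have h := ((hK ε).mul_mul_conjTranspose_same (1 - Y ε)).trace_nonneg
    rwa [hYH, Matrix.mul_assoc, Matrix.trace_mul_comm, Matrix.mul_assoc] at h
  have hKY : ∑ ε, K ε * Y ε = q • (1 : Matrix m m ℂ) := by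
    simp only [hY, Finset.mul_sum]
    rw [Finset.sum_comm, hq, Finset.sum_smul]
    refine Finset.sum_congr rfl fun i _ => ?_
    calc ∑ ε, K ε * (boolSign (ε i) * s i) • F i
        = s i • ((∑ ε, boolSign (ε i) • K ε) * F i) := by
          rw [Finset.sum_mul, Finset.smul_sum]
          refine Finset.sum_congr rfl fun ε _ => ?_
          rw [Matrix.mul_smul, Matrix.smul_mul, smul_smul, mul_comm]
      _ = s i ^ 2 • 1 := by
          rw [hmarg, Matrix.smul_mul, hsq, smul_smul, pow_two]
  have htotal : ∑ ε, K ε * ((1 - Y ε) * (1 - Y ε)) = (1 - q) • (1 : Matrix m m ℂ) := by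
    simp only [hYsq, Matrix.mul_sub, Matrix.mul_smul, Matrix.mul_one, Finset.sum_sub_distrib,
      ← Finset.smul_sum, hsum, hKY]
    module
  have hnonneg : 0 ≤ ((1 - q) • (1 : Matrix m m ℂ)).trace := by
    rw [← htotal, Matrix.trace_sum]
    exact Finset.sum_nonneg fun ε _ => hpos ε
  rw [Matrix.trace_smul, Matrix.trace_one, Complex.real_smul] at hnonneg
  have hre : 0 ≤ (1 - q) * (Fintype.card m : ℝ) := by exact_mod_cast hnonneg
  have hcard : (0 : ℝ) < Fintype.card m := by exact_mod_cast Fintype.card_pos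
  linarith [nonneg_of_mul_nonneg_left hre hcard]

end Clifford

lemma exists_isometry_of_card_le {m n : Type} [Fintype m] [DecidableEq m] [Fintype n]
    [DecidableEq n] (h : Fintype.card m ≤ Fintype.card n) :
    ∃ V : Matrix n m ℂ, Vᴴ * V = 1 := by
  obtain ⟨e⟩ := Function.Embedding.nonempty_of_card_le h
  refine ⟨(1 : Matrix n n ℂ).submatrix id e, ?_⟩
  rw [conjTranspose_submatrix, conjTranspose_one,
    ← submatrix_mul _ _ e id e Function.bijective_id, Matrix.one_mul,
    submatrix_one e e.injective]

lemma sum_sq_le_one_of_mem_gammaD {g d : ℕ} (hd : 2 ^ (g / 2) ≤ d) {s : Fin g → ℝ}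
    (hs : s ∈ GammaD g d) : ∑ i, s i ^ 2 ≤ 1 := by
  obtain ⟨m, _, _, F, hcard, hH, hsq, hanti⟩ := exists_anticommuting_reflections (g / 2)
  have hle : g ≤ 2 * (g / 2) + 1 := by omega
  have : Nonempty m := Fintype.card_pos_iff.mp (by rw [hcard]; positivity)
  obtain ⟨V, hV⟩ := exists_isometry_of_card_le (m := m) (n := Fin d) (by simpa [hcard] using hd)
  have hpsd : ∀ i, ((1 / 2 : ℝ) • (1 + F i)).PosSemidef := fun i => by
    have h := (posSemidef_conjTranspose_mul_self (1 + F i)).smul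
      (show (0 : ℝ) ≤ 1 / 4 by norm_num)
    convert h using 1
    rw [conjTranspose_add, conjTranspose_one, hH, add_mul, mul_add, mul_add, hsq,
      Matrix.one_mul, Matrix.one_mul, Matrix.mul_one]
    module
  have hpsd' : ∀ i, (1 - (1 / 2 : ℝ) • (1 + F i)).PosSemidef := fun i => by
    have h := (posSemidef_conjTranspose_mul_self (1 - F i)).smul
      (show (0 : ℝ) ≤ 1 / 4 by norm_num)
    convert h using 1
    rw [conjTranspose_sub, conjTranspose_one, hH, sub_mul, mul_sub, mul_sub, hsq,
      Matrix.one_mul, Matrix.one_mul, Matrix.mul_one]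
    module
  have hcomp := hs.2 (fun i => V * ((1 / 2 : ℝ) • (1 + F (Fin.castLE hle i))) * Vᴴ) fun i =>
    ⟨(hpsd _).mul_mul_conjTranspose_same V, posSemidef_one_sub_conj hV (hpsd' _)⟩
  have hJ := ((compatibleEffects_iff_jointSigned _).mp hcomp).compress hV
  refine sum_sq_le_one_of_jointSigned (F := fun i => F (Fin.castLE hle i)) (fun i => hH _)
    (fun i => hsq _) (fun i j hij => hanti _ _ fun e => hij (Fin.castLE_injective hle e)) ?_
  convert hJ using 1
  funext i
  simp only [Matrix.mul_sub, Matrix.sub_mul, smul_add, Matrix.mul_add, Matrix.add_mul,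
    Matrix.mul_smul, Matrix.smul_mul, Matrix.mul_one, hV]
  have hVF := compress_conj hV (F (Fin.castLE hle i))
  have hVV := compress_conj hV 1
  rw [Matrix.mul_one] at hVV
  rw [hVF, hVV]
  module

lemma compatibleEffects_of_sum_sq_le_one {g d : ℕ} {s : Fin g → ℝ} (hs : ∑ i, s i ^ 2 ≤ 1)
    {E : Fin g → Matrix (Fin d) (Fin d) ℂ} (hE : ∀ i, IsEffect (E i)) :
    CompatibleEffects (fun i => s i • E i +
      ((1 - s i) * (2 : ℝ)⁻¹) • (1 : Matrix (Fin d) (Fin d) ℂ)) := by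
  rw [compatibleEffects_iff_jointSigned]
  have hJ := jointSigned_of_sum_sq_le_one (fun i => (2 : ℝ) • E i - 1)
    (fun i => by
      convert (hE i).2.smul (show (0 : ℝ) ≤ 2 by norm_num) using 1
      module)
    (fun i => by
      convert (hE i).1.smul (show (0 : ℝ) ≤ 2 by norm_num) using 1
      module) s hs
  convert hJ using 1
  funext i
  module

/-- for `d ≥ 2 ^ ⌈(g-1)/2⌉` (i.e. `2 ^ (g / 2)` in natural division, `g ≥ 1`),
`Γ(g,d) = {s ∈ [0,1]^g : ∑ s i ^ 2 ≤ 1}`. -/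
theorem gamma_eq_qc (g d : ℕ) (hg : 0 < g) (hd : 2 ^ (g / 2) ≤ d) :
    GammaD g d =
      {s : Fin g → ℝ | (∀ i, s i ∈ Set.Icc (0 : ℝ) 1) ∧ ∑ i, s i ^ 2 ≤ 1} := by
  ext s
  exact ⟨fun hs => ⟨hs.1, sum_sq_le_one_of_mem_gammaD hd hs⟩,
    fun hs => ⟨hs.1, fun _ hE => compatibleEffects_of_sum_sq_le_one hs.2 hE⟩⟩
end
end
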